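/- Let |ψ⟩ be a stabilizer state on n qubits, let ω be a minimal support of 𝒮(ψ), and let M, M′ ∈ 𝒮(ψ) be two distinct elements with support equal to ω. Then: (a) for every i ∈ ω, the tensor factors satisfy σ₀ ≠ Mᵢ ≠ M′ᵢ ≠ σ₀; (b) supp(MM′) = ω, and for every i ∈ ω the set {Mᵢ, M′ᵢ, (MM′)ᵢ} equals {σₓ, σ_y, σ_z}; and (c) M, M′, and MM′ are the only elements of 𝒮(ψ) with support equal to ω. -/

import Mathlib

open Matrix

noncomputable section

/-- Pauli matrices: `0 ↦ σ₀` (identity), `1 ↦ σₓ`, `2 ↦ σ_y`, `3 ↦ σ_z`. -/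
def pauliMat : Fin 4 → Matrix (Fin 2) (Fin 2) ℂ :=
  ![1, !![0, 1; 1, 0], !![0, -Complex.I; Complex.I, 0], !![1, 0; 0, -1]]

/-- Tensor (Kronecker) product of a family of one-qubit operators, as an operator
on qubits indexed by `ι`. -/
def kron {ι : Type} [Fintype ι] (U : ι → Matrix (Fin 2) (Fin 2) ℂ) :
    Matrix (ι → Fin 2) (ι → Fin 2) ℂ :=
  Matrix.of fun x y => ∏ i, U i (x i) (y i)

/-- An element of the Pauli group: a phase in `{1, -1, i, -i}` together with a
Pauli label (`σ₀, σₓ, σ_y, σ_z`) on every qubit. -/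
structure PauliOp (ι : Type) where
  phase : ℂ
  label : ι → Fin 4
  phase_ok : phase = 1 ∨ phase = -1 ∨ phase = Complex.I ∨ phase = -Complex.I

noncomputable instance {ι : Type} : DecidableEq (PauliOp ι) := Classical.decEq _

/-- The matrix of a Pauli group element. -/
def PauliOp.toMatrix {ι : Type} [Fintype ι] (M : PauliOp ι) :
    Matrix (ι → Fin 2) (ι → Fin 2) ℂ :=
  M.phase • kron fun i => pauliMat (M.label i)

/-- The support of a Pauli operator: the set of qubits on which it acts nontrivially. -/
def PauliOp.support {ι : Type} [Fintype ι] [DecidableEq ι] (M : PauliOp ι) : Finset ι :=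
  Finset.univ.filter fun i => M.label i ≠ 0

/-- A (maximal) stabilizer on the qubits indexed by `ι`: an abelian subgroup of the
Pauli group of cardinality `2^|ι|` which does not contain `-I`. -/
structure Stabilizer (ι : Type) [Fintype ι] [DecidableEq ι] where
  elems : Finset (PauliOp ι)
  one_mem : ∃ M ∈ elems, PauliOp.toMatrix M = 1
  mul_mem : ∀ M ∈ elems, ∀ N ∈ elems, ∃ K ∈ elems,
    PauliOp.toMatrix K = PauliOp.toMatrix M * PauliOp.toMatrix N
  comm : ∀ M ∈ elems, ∀ N ∈ elems,
    PauliOp.toMatrix M * PauliOp.toMatrix N = PauliOp.toMatrix N * PauliOp.toMatrix M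
  neg_one_not_mem : ∀ M ∈ elems, PauliOp.toMatrix M ≠ -1
  card_elems : elems.card = 2 ^ Fintype.card ι

variable {ι : Type} [Fintype ι] [DecidableEq ι]

/-- `ψ` is the stabilizer state of the stabilizer `S`: it is a unit vector fixed by
every element of `S`. -/
def stabilizesState (S : Stabilizer ι) (ψ : (ι → Fin 2) → ℂ) : Prop :=
  (∑ x, Complex.normSq (ψ x)) = 1 ∧ ∀ M ∈ S.elems, (PauliOp.toMatrix M).mulVec ψ = ψ

/-- `ψ` is a stabilizer state. -/
def IsStabilizerState (ψ : (ι → Fin 2) → ℂ) : Prop :=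
  ∃ S : Stabilizer ι, stabilizesState S ψ

/-- `A_ω(ψ)`: the number of stabilizer elements with support exactly `ω`. -/
def Aomega (S : Stabilizer ι) (ω : Finset ι) : ℕ :=
  (S.elems.filter fun M => PauliOp.support M = ω).card

/-- `ω` is a minimal support of `S`: it is the support of some element of `S`, and no
element of `S` has nonempty support strictly contained in `ω`. -/
def IsMinimalSupport (S : Stabilizer ι) (ω : Finset ι) : Prop :=
  (∃ M ∈ S.elems, PauliOp.support M = ω) ∧
    ∀ M ∈ S.elems, PauliOp.support M ⊂ ω → PauliOp.support M = ∅

/-- The matrices of the minimal elements of `S` (the elements whose support is a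
minimal support). -/
def minimalMatrices (S : Stabilizer ι) : Set (Matrix (ι → Fin 2) (ι → Fin 2) ℂ) :=
  {A | ∃ M ∈ S.elems, IsMinimalSupport S (PauliOp.support M) ∧ PauliOp.toMatrix M = A}

/-- `M` belongs to the subgroup `ℳ(ψ)` of `S` generated by the minimal elements.
(Every stabilizer element is an involution, so the generated submonoid coincides with
the generated subgroup.) -/
def inMinimalSubgroup (S : Stabilizer ι) (M : PauliOp ι) : Prop :=
  M ∈ S.elems ∧ PauliOp.toMatrix M ∈ Submonoid.closure (minimalMatrices S)

/-- A one-qubit Clifford operation: a unitary mapping each of the three Pauli matrices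
to a Pauli matrix, up to sign, under conjugation. -/
def IsClifford (U : Matrix (Fin 2) (Fin 2) ℂ) : Prop :=
  U ∈ Matrix.unitaryGroup (Fin 2) ℂ ∧
    ∃ π : Equiv.Perm (Fin 3), ∀ u : Fin 3, ∃ s : ℂ, (s = 1 ∨ s = -1) ∧
      U * pauliMat u.succ * Uᴴ = s • pauliMat (π u).succ

/-- Local unitary equivalence of pure states. -/
def LUequiv (ψ φ : (ι → Fin 2) → ℂ) : Prop :=
  ∃ U : ι → Matrix (Fin 2) (Fin 2) ℂ,
    (∀ i, U i ∈ Matrix.unitaryGroup (Fin 2) ℂ) ∧ (kron U).mulVec ψ = φ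

/-- Local Clifford equivalence of pure states. -/
def LCequiv (ψ φ : (ι → Fin 2) → ℂ) : Prop :=
  ∃ U : ι → Matrix (Fin 2) (Fin 2) ℂ,
    (∀ i, IsClifford (U i)) ∧ (kron U).mulVec ψ = φ

/-- Local Clifford equivalence of (possibly mixed) states. -/
def LCequivMixed (ρ ρ' : Matrix (ι → Fin 2) (ι → Fin 2) ℂ) : Prop :=
  ∃ U : ι → Matrix (Fin 2) (Fin 2) ℂ,
    (∀ i, IsClifford (U i)) ∧ kron U * ρ * (kron U)ᴴ = ρ'

/-- A pure state is fully entangled if it is not a tensor product of states on two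
complementary nonempty subsets of the qubits. -/
def FullyEntangled (ψ : (ι → Fin 2) → ℂ) : Prop :=
  ¬ ∃ (ω : Finset ι) (φ : ({i // i ∈ ω} → Fin 2) → ℂ) (χ : ({i // i ∉ ω} → Fin 2) → ℂ),
      ω ≠ ∅ ∧ ω ≠ Finset.univ ∧
        ∀ x : ι → Fin 2, ψ x = φ (fun i => x i.1) * χ (fun i => x i.1)

/-- Recombine an assignment on `ω` and one on its complement into a global assignment. -/
def mergeAssign (ω : Finset ι) (x : {i // i ∈ ω} → Fin 2) (z : {i // i ∉ ω} → Fin 2) :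
    ι → Fin 2 :=
  fun i => if h : i ∈ ω then x ⟨i, h⟩ else z ⟨i, h⟩

/-- The reduced density matrix `ρ_ω(ψ)` of the pure state `ψ` on the qubits in `ω`
(partial trace of `|ψ⟩⟨ψ|` over the qubits outside `ω`). -/
def reducedState (ψ : (ι → Fin 2) → ℂ) (ω : Finset ι) :
    Matrix ({i // i ∈ ω} → Fin 2) ({i // i ∈ ω} → Fin 2) ℂ :=
  Matrix.of fun x y =>
    ∑ z : {i // i ∉ ω} → Fin 2, ψ (mergeAssign ω x z) * (starRingEnd ℂ) (ψ (mergeAssign ω y z))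

/-- The restriction `α_M M_{i₁} ⊗ ⋯ ⊗ M_{i_k}` of a Pauli operator to the qubits in `ω`. -/
def PauliOp.restrict (M : PauliOp ι) (ω : Finset ι) :
    Matrix ({i // i ∈ ω} → Fin 2) ({i // i ∈ ω} → Fin 2) ℂ :=
  M.phase • kron fun i : {i // i ∈ ω} => pauliMat (M.label i.1)

/-- The `n`-qubit GHZ state `(|0…0⟩ + |1…1⟩)/√2`. -/
def ghz (n : ℕ) : (Fin n → Fin 2) → ℂ :=
  fun x => if x = (fun _ => 0) ∨ x = (fun _ => 1) then ((Real.sqrt 2 : ℝ)⁻¹ : ℂ) else 0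

/-- The `2n × 2n` binary symplectic form `P = [[0, I], [I, 0]]`. -/
def Pmat (n : ℕ) : Matrix (Fin n ⊕ Fin n) (Fin n ⊕ Fin n) (ZMod 2) :=
  Matrix.fromBlocks 0 1 1 0

end

section PauliProducts

lemma PauliOp.phase_ne_zero {ι : Type} (M : PauliOp ι) : M.phase ≠ 0 := by
  rcases M.phase_ok with h | h | h | h <;> simp [h]

variable {ι : Type} [Fintype ι]

lemma kron_mul [DecidableEq ι] (U V : ι → Matrix (Fin 2) (Fin 2) ℂ) :
    kron U * kron V = kron fun i => U i * V i := by
  ext x y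
  simp only [kron, Matrix.mul_apply, Matrix.of_apply, ← Finset.prod_mul_distrib]
  rw [Finset.prod_univ_sum, Fintype.piFinset_univ]

lemma trace_kron [DecidableEq ι] (U : ι → Matrix (Fin 2) (Fin 2) ℂ) :
    (kron U).trace = ∏ i, (U i).trace := by
  simp only [kron, Matrix.trace, Matrix.diag, Matrix.of_apply]
  rw [Finset.prod_univ_sum, Fintype.piFinset_univ]

lemma kron_smul (c : ι → ℂ) (U : ι → Matrix (Fin 2) (Fin 2) ℂ) :
    (kron fun i => c i • U i) = (∏ i, c i) • kron U := by
  ext x y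
  simp [kron, Finset.prod_mul_distrib]

/-- Up to a nonzero phase, the product of two Pauli matrices is the Pauli matrix whose
label is the bitwise sum of the two labels. -/
lemma exists_pauliMat_mul (a b : Fin 4) :
    ∃ c : ℂ, c ≠ 0 ∧ pauliMat a * pauliMat b = c • pauliMat (a ^^^ b) := by
  have h1 : ∀ A B : Matrix (Fin 2) (Fin 2) ℂ, A = B → ∃ c : ℂ, c ≠ 0 ∧ A = c • B :=
    fun A B h => ⟨1, one_ne_zero, by simp [h]⟩
  have hI : ∀ A B : Matrix (Fin 2) (Fin 2) ℂ, A = Complex.I • B → ∃ c : ℂ, c ≠ 0 ∧ A = c • B :=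
    fun A B h => ⟨Complex.I, Complex.I_ne_zero, h⟩
  have hJ : ∀ A B : Matrix (Fin 2) (Fin 2) ℂ,
      A = (-Complex.I) • B → ∃ c : ℂ, c ≠ 0 ∧ A = c • B :=
    fun A B h => ⟨-Complex.I, neg_ne_zero.mpr Complex.I_ne_zero, h⟩
  fin_cases a <;> fin_cases b <;>
    first
    | (apply h1; ext i j; fin_cases i <;> fin_cases j <;>
        simp [pauliMat, Matrix.mul_apply, Matrix.one_apply]; done)
    | (apply hI; ext i j; fin_cases i <;> fin_cases j <;>
        simp [pauliMat, Matrix.mul_apply]; done)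
    | (apply hJ; ext i j; fin_cases i <;> fin_cases j <;> simp [pauliMat, Matrix.mul_apply])

lemma trace_pauliMat_mul_self (a : Fin 4) : (pauliMat a * pauliMat a).trace ≠ 0 := by
  fin_cases a <;> simp [pauliMat, Matrix.trace]

lemma trace_pauliMat_mul_of_ne {a b : Fin 4} (h : a ≠ b) :
    (pauliMat a * pauliMat b).trace = 0 := by
  fin_cases a <;> fin_cases b <;> first
    | exact absurd rfl h
    | simp [pauliMat, Matrix.trace]

lemma PauliOp.label_eq_of_toMatrix_eq_smul [DecidableEq ι] (K : PauliOp ι) {c : ℂ}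
    (L : ι → Fin 4) (h : K.toMatrix = c • kron fun i => pauliMat (L i)) : K.label = L := by
  by_contra hne
  obtain ⟨i, hi⟩ := Function.ne_iff.mp hne
  have htr := congrArg (fun A => (A * kron fun i => pauliMat (K.label i)).trace) h
  simp only [PauliOp.toMatrix, Matrix.smul_mul, kron_mul, Matrix.trace_smul, trace_kron,
    smul_eq_mul] at htr
  rw [Finset.prod_eq_zero (f := fun i => (pauliMat (L i) * pauliMat (K.label i)).trace)
    (Finset.mem_univ i) (trace_pauliMat_mul_of_ne (Ne.symm hi)), mul_zero] at htr
  exact mul_ne_zero K.phase_ne_zero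
    (Finset.prod_ne_zero_iff.mpr fun j _ => trace_pauliMat_mul_self _) htr

lemma PauliOp.label_of_toMatrix_eq_mul [DecidableEq ι] {K M N : PauliOp ι}
    (h : K.toMatrix = M.toMatrix * N.toMatrix) (i : ι) :
    K.label i = M.label i ^^^ N.label i := by
  choose c _ hc using exists_pauliMat_mul
  refine congrFun (K.label_eq_of_toMatrix_eq_smul
    (c := M.phase * N.phase * ∏ i, c (M.label i) (N.label i))
    (fun i => M.label i ^^^ N.label i) ?_) i
  rw [h]
  simp only [PauliOp.toMatrix, Matrix.smul_mul, Matrix.mul_smul, kron_mul, hc, kron_smul,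
    smul_smul]
  congr 1
  ring

lemma PauliOp.mem_support [DecidableEq ι] {M : PauliOp ι} {i : ι} :
    i ∈ M.support ↔ M.label i ≠ 0 := by
  simp [PauliOp.support]

lemma stabilizesState.eq_of_label_eq [DecidableEq ι] {S : Stabilizer ι}
    {ψ : (ι → Fin 2) → ℂ} (hψ : stabilizesState S ψ) {M N : PauliOp ι}
    (hM : M ∈ S.elems) (hN : N ∈ S.elems) (h : M.label = N.label) : M = N := by
  have h1 := hψ.2 M hM
  have h2 := hψ.2 N hN
  simp only [PauliOp.toMatrix, Matrix.smul_mulVec, h] at h1 h2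
  have hψ0 : ψ ≠ 0 := by
    rintro rfl
    simpa using hψ.1
  have hv : (kron fun i => pauliMat (N.label i)) *ᵥ ψ ≠ 0 := by
    intro hv
    rw [hv, smul_zero] at h2
    exact hψ0 h2.symm
  have hp : M.phase = N.phase := smul_left_injective ℂ hv (h1.trans h2.symm)
  cases M
  cases N
  simp_all

/-- Distinct stabilizer elements with the same minimal support differ everywhere on it. -/
lemma IsMinimalSupport.label_ne [DecidableEq ι] {S : Stabilizer ι}
    {ψ : (ι → Fin 2) → ℂ} (hψ : stabilizesState S ψ) {ω : Finset ι}
    (hω : IsMinimalSupport S ω) {M N : PauliOp ι} (hM : M ∈ S.elems) (hN : N ∈ S.elems)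
    (hne : M ≠ N) (hsM : M.support = ω) (hsN : N.support = ω) {i : ι} (hi : i ∈ ω) :
    M.label i ≠ N.label i := by
  intro heq
  obtain ⟨K, hK, hKmul⟩ := S.mul_mem M hM N hN
  have hlab := PauliOp.label_of_toMatrix_eq_mul hKmul
  have hself : ∀ a : Fin 4, a ^^^ a = 0 := by decide
  have hzero : ∀ a b : Fin 4, a ^^^ b = 0 → a = b := by decide
  have hss : K.support ⊂ ω := by
    refine (Finset.ssubset_iff_of_subset fun j hj => ?_).mpr ⟨i, hi, ?_⟩
    · by_contra hjω
      have hMj : M.label j = 0 := by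
        by_contra h0
        exact hjω (hsM ▸ PauliOp.mem_support.mpr h0)
      have hNj : N.label j = 0 := by
        by_contra h0
        exact hjω (hsN ▸ PauliOp.mem_support.mpr h0)
      exact PauliOp.mem_support.mp hj (by rw [hlab, hMj, hNj, hself])
    · rw [PauliOp.mem_support, not_not, hlab, heq, hself]
  have hempty := hω.2 K hK hss
  refine hne (hψ.eq_of_label_eq hM hN (funext fun j => hzero _ _ ?_))
  rw [← hlab]
  by_contra h0
  simpa [hempty] using PauliOp.mem_support.mpr h0

end PauliProducts

/-- Let `ω` be a minimal support of `𝒮(ψ)` and let `M ≠ M'` be elements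
of `𝒮(ψ)` with support `ω`. Then (a) on every `i ∈ ω` the tensor factors of `M` and `M'`
are nonidentity and distinct; (b) `supp(MM') = ω` and on each `i ∈ ω` the factors of
`M, M', MM'` are exactly `{σₓ, σ_y, σ_z}`; (c) `M, M', MM'` are the only elements of
`𝒮(ψ)` with support `ω`. -/
theorem stmt_14 {n : ℕ} (S : Stabilizer (Fin n)) (ψ : (Fin n → Fin 2) → ℂ)
    (hψ : stabilizesState S ψ) (ω : Finset (Fin n)) (hω : IsMinimalSupport S ω)
    (M M' : PauliOp (Fin n)) (hM : M ∈ S.elems) (hM' : M' ∈ S.elems) (hne : M ≠ M')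
    (hsM : PauliOp.support M = ω) (hsM' : PauliOp.support M' = ω) :
    (∀ i ∈ ω, M.label i ≠ 0 ∧ M'.label i ≠ 0 ∧ M.label i ≠ M'.label i) ∧
    ∀ K ∈ S.elems, PauliOp.toMatrix K = PauliOp.toMatrix M * PauliOp.toMatrix M' →
      PauliOp.support K = ω ∧
      (∀ i ∈ ω, ({M.label i, M'.label i, K.label i} : Finset (Fin 4)) = {1, 2, 3}) ∧
      (∀ N ∈ S.elems, PauliOp.support N = ω → N = M ∨ N = M' ∨ N = K) := by
  have ha : ∀ i ∈ ω, M.label i ≠ 0 ∧ M'.label i ≠ 0 ∧ M.label i ≠ M'.label i := fun i hi =>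
    ⟨PauliOp.mem_support.mp (hsM ▸ hi), PauliOp.mem_support.mp (hsM' ▸ hi),
      hω.label_ne hψ hM hM' hne hsM hsM' hi⟩
  refine ⟨ha, fun K hK hKmul => ?_⟩
  have hlab := PauliOp.label_of_toMatrix_eq_mul hKmul
  have hfactors : ∀ a b : Fin 4, a ≠ 0 → b ≠ 0 → a ≠ b →
      a ^^^ b ≠ 0 ∧ ({a, b, a ^^^ b} : Finset (Fin 4)) = {1, 2, 3} := by decide
  have hoff : ∀ L : PauliOp (Fin n), L.support = ω → ∀ j ∉ ω, L.label j = 0 := by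
    intro L hL j hj
    by_contra h0
    exact hj (hL ▸ PauliOp.mem_support.mpr h0)
  have hsK : K.support = ω := by
    ext j
    rw [PauliOp.mem_support, hlab]
    by_cases hj : j ∈ ω
    · obtain ⟨h1, h2, h3⟩ := ha j hj
      exact iff_of_true (hfactors _ _ h1 h2 h3).1 hj
    · refine iff_of_false ?_ hj
      rw [hoff M hsM j hj, hoff M' hsM' j hj]
      decide
  have hset : ∀ i ∈ ω, ({M.label i, M'.label i, K.label i} : Finset (Fin 4)) = {1, 2, 3} := by
    intro i hi
    obtain ⟨h1, h2, h3⟩ := ha i hi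
    rw [hlab]
    exact (hfactors _ _ h1 h2 h3).2
  refine ⟨hsK, hset, fun N hN hsN => ?_⟩
  by_contra! hcon
  obtain ⟨hNM, hNM', hNK⟩ := hcon
  obtain ⟨i, hi⟩ : ω.Nonempty := by
    by_contra hemp
    rw [Finset.not_nonempty_iff_eq_empty] at hemp
    refine hne (hψ.eq_of_label_eq hM hM' (funext fun j => ?_))
    rw [hoff M hsM j (by simp [hemp]), hoff M' hsM' j (by simp [hemp])]
  have hmem : N.label i ∈ ({M.label i, M'.label i, K.label i} : Finset (Fin 4)) := by
    have hnonzero : ∀ a : Fin 4, a ≠ 0 → a ∈ ({1, 2, 3} : Finset (Fin 4)) := by decide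
    rw [hset i hi]
    exact hnonzero _ (PauliOp.mem_support.mp (hsN ▸ hi))
  simp only [Finset.mem_insert, Finset.mem_singleton] at hmem
  rcases hmem with h | h | h
  · exact hω.label_ne hψ hN hM hNM hsN hsM hi h
  · exact hω.label_ne hψ hN hM' hNM' hsN hsM' hi h
  · exact hω.label_ne hψ hN hK hNK hsN hsK hi h
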